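/- arXiv:1205.6706 — 2 statements merged into one kernel-verified Lean document; each statement's English description precedes it below -/
import Mathlib

section
/- For every natural number m, the Gauss hypergeometric series evaluated at 1 satisfies ₂F₁(1/2 + m, 1/2 − m; 3/2 + m; 1) = (π / 2^(2m+1)) · (3/2)_m / m!. -/
open scoped Nat

/-- Pochhammer symbol `(x)_k = x (x+1) ⋯ (x+k-1)` for a complex number `x`. -/
noncomputable def poch (x : ℂ) (k : ℕ) : ℂ := (ascPochhammer ℂ k).eval x

/-- The generalized hypergeometric series
`ₚF_q(a₁,…,aₚ; b₁,…,b_q; z) = ∑ₖ ((a₁)ₖ ⋯ (aₚ)ₖ)/((b₁)ₖ ⋯ (b_q)ₖ) · zᵏ/k!`. -/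
noncomputable def hyp (a b : List ℂ) (z : ℂ) : ℂ :=
  ∑' k : ℕ, ((a.map (poch · k)).prod / (b.map (poch · k)).prod) * z ^ k / (k ! : ℂ)

/-- If `b < 1`, the terms `(b)ₖ / (k! (k + 1))` are absolutely summable. -/
lemma summable_norm_poch_div_factorial_div_succ {b : ℝ} (hb : b < 1) :
    Summable fun k : ℕ => ‖poch b k / (k ! : ℂ)‖ / (k + 1 : ℝ) := by
  set c : ℕ → ℝ := fun k => ‖poch b k / (k ! : ℂ)‖ with hc
  obtain ⟨N, hN⟩ := exists_nat_ge (-b)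
  have hstep (k : ℕ) : c (k + 1) = c k * (|b + k| / (k + 1)) := by
    have h1 : poch b (k + 1) / ((k + 1)! : ℂ) =
        poch b k / (k ! : ℂ) * (((b + k) / (k + 1) : ℝ) : ℂ) := by
      rw [poch, ascPochhammer_succ_eval, Nat.factorial_succ, poch]
      push_cast
      have : (k ! : ℂ) ≠ 0 := by exact_mod_cast k.factorial_ne_zero
      have : (k : ℂ) + 1 ≠ 0 := by exact_mod_cast k.succ_ne_zero
      field_simp
    simp only [hc]
    rw [h1, norm_mul, Complex.norm_real, Real.norm_eq_abs, abs_div,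
      abs_of_pos (by positivity : (0 : ℝ) < k + 1)]
  have htel (k : ℕ) (hk : N ≤ k) : c k / (k + 1) = (c k - c (k + 1)) / (1 - b) := by
    have hk' : (N : ℝ) ≤ k := by exact_mod_cast hk
    have : 1 - b ≠ 0 := by linarith
    rw [hstep, abs_of_nonneg (by linarith)]
    field_simp
    ring
  rw [← summable_nat_add_iff N]
  refine summable_of_sum_range_le (c := c N / (1 - b)) (fun k => by positivity) fun n => ?_
  have hsum : ∑ i ∈ Finset.range n, c (i + N) / (((i + N : ℕ) : ℝ) + 1) =
      (c N - c (n + N)) / (1 - b) := by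
    induction n with
    | zero => simp
    | succ n ih =>
      rw [Finset.sum_range_succ, ih, htel _ (Nat.le_add_left N n),
        show n + 1 + N = n + N + 1 by ring]
      ring
  rw [hsum]
  have : 0 ≤ c (n + N) := norm_nonneg _
  gcongr
  all_goals linarith

/-- The **binomial series** with coefficients written as Pochhammer symbols. -/
lemma hasSum_poch_div_factorial_mul_pow (b : ℂ) {z : ℂ} (hz : ‖z‖ < 1) :
    HasSum (fun k : ℕ => poch b k / (k ! : ℂ) * z ^ k) ((1 - z) ^ (-b)) := by
  have h := (Complex.one_div_one_sub_cpow_hasFPowerSeriesOnBall_zero b).hasSum (y := z)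
    (by
      rwa [Metric.mem_eball, edist_zero_right, ← ofReal_norm, ENNReal.ofReal_lt_one])
  simp only [FormalMultilinearSeries.ofScalars_apply_eq, zero_add, smul_eq_mul] at h
  rw [Complex.cpow_neg, ← one_div]
  have hcoef (k : ℕ) : Ring.choose (b + k - 1) k = poch b k / (k ! : ℂ) := by
    have hk : (k ! : ℂ) ≠ 0 := by exact_mod_cast k.factorial_ne_zero
    rw [← Ring.multichoose_eq, poch, ← Polynomial.ascPochhammer_smeval_eq_eval,
      ← Ring.factorial_nsmul_multichoose_eq_ascPochhammer, nsmul_eq_mul, mul_div_cancel_left₀ _ hk]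
  simp only [hcoef] at h
  exact h

open MeasureTheory Set in
/-- Termwise integration of the binomial series against `x ^ (a - 1)` on `[0, 1]`. -/
lemma hasSum_poch_div_factorial_div_add {a : ℂ} {b : ℝ} (ha : 0 < a.re) (hb : b < 1) :
    HasSum (fun k : ℕ => poch b k / (k ! : ℂ) / (a + k)) (Complex.betaIntegral a (1 - b)) := by
  set c : ℕ → ℂ := fun k => poch b k / (k ! : ℂ) with hc
  set F : ℕ → ℝ → ℂ := fun k x => c k * (x : ℂ) ^ (a + k - 1) with hF
  have hre (k : ℕ) : -1 < (a + k - 1).re := by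
    simp
    positivity
  have hint (k : ℕ) : Integrable (F k) (volume.restrict (Ioc 0 1)) := by
    have := (intervalIntegral.intervalIntegrable_cpow' (hre k) (a := 0) (b := 1)).const_mul (c k)
    rwa [intervalIntegrable_iff_integrableOn_Ioc_of_le zero_le_one] at this
  have hval (k : ℕ) : ∫ x in Ioc (0 : ℝ) 1, F k x = c k / (a + k) := by
    have hne : a + k ≠ 0 := fun h => by
      have := hre k
      rw [h] at this
      simp at this
    rw [← intervalIntegral.integral_of_le zero_le_one]
    simp only [hF]
    rw [intervalIntegral.integral_const_mul, integral_cpow (Or.inl (hre k))]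
    simp [hne, div_eq_mul_inv]
  have hnorm (k : ℕ) : ∫ x in Ioc (0 : ℝ) 1, ‖F k x‖ = ‖c k‖ / (a.re + k) := by
    have hpos : a.re + k ≠ 0 := by positivity
    have : ∫ x in Ioc (0 : ℝ) 1, ‖F k x‖ = ∫ x in Ioc (0 : ℝ) 1, ‖c k‖ * x ^ (a.re + k - 1) := by
      refine setIntegral_congr_fun measurableSet_Ioc fun x hx => ?_
      simp only [hF]
      rw [norm_mul, Complex.norm_cpow_eq_rpow_re_of_pos hx.1]
      simp
    rw [this, ← intervalIntegral.integral_of_le zero_le_one,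
      intervalIntegral.integral_const_mul, integral_rpow (Or.inl (by simpa using hre k))]
    simp [hpos, div_eq_mul_inv]
  have hsum : Summable fun k => ∫ x in Ioc (0 : ℝ) 1, ‖F k x‖ := by
    simp only [hnorm]
    refine Summable.of_nonneg_of_le (fun k => by positivity) (fun k => ?_)
      ((summable_norm_poch_div_factorial_div_succ hb).mul_left (1 + 1 / a.re))
    rw [mul_div_assoc', div_le_div_iff₀ (by positivity) (by positivity)]
    have : (k : ℝ) + 1 ≤ (1 + 1 / a.re) * (a.re + k) := by
      have : (1 + 1 / a.re) * (a.re + k) = k + 1 + (a.re + k / a.re) := by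
        field_simp
        ring
      rw [this]
      have : 0 ≤ a.re + k / a.re := by positivity
      linarith
    calc ‖c k‖ * (k + 1) ≤ ‖c k‖ * ((1 + 1 / a.re) * (a.re + k)) := by gcongr
      _ = _ := by simp only [hc]; ring
  have key := hasSum_integral_of_summable_integral_norm hint hsum
  simp only [hval] at key
  suffices h : Complex.betaIntegral a (1 - b) = ∫ x in Ioc (0 : ℝ) 1, ∑' k, F k x by rwa [h]
  rw [Complex.betaIntegral, intervalIntegral.integral_of_le zero_le_one,
    integral_Ioc_eq_integral_Ioo, integral_Ioc_eq_integral_Ioo]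
  refine setIntegral_congr_fun measurableSet_Ioo fun x hx => ?_
  have hx0 : (x : ℂ) ≠ 0 := by exact_mod_cast hx.1.ne'
  have hx1 : ‖(x : ℂ)‖ < 1 := by
    rw [Complex.norm_real, Real.norm_of_nonneg hx.1.le]
    exact hx.2
  have h := (hasSum_poch_div_factorial_mul_pow b hx1).mul_left ((x : ℂ) ^ (a - 1))
  rw [show (1 : ℂ) - b - 1 = -b by ring, ← h.tsum_eq]
  refine tsum_congr fun k => ?_
  simp only [hF, hc]
  rw [show a + k - 1 = a - 1 + k by ring, Complex.cpow_add _ _ hx0, Complex.cpow_natCast]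
  ring

lemma poch_div_poch_add_one {a : ℂ} (ha : 0 < a.re) (k : ℕ) :
    poch a k / poch (a + 1) k = a / (a + k) := by
  have hne (n : ℕ) : a + n ≠ 0 := fun h => by
    have := congrArg Complex.re h
    simp at this
    have : (0 : ℝ) ≤ n := n.cast_nonneg
    linarith
  have ha0 : a ≠ 0 := by simpa using hne 0
  induction k with
  | zero => simp [poch, ha0]
  | succ k ih =>
    have h1 := hne k
    have h2 := hne (k + 1)
    push_cast at h2 ⊢
    rw [poch, ascPochhammer_succ_eval, poch, ascPochhammer_succ_eval, mul_div_mul_comm]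
    change poch a k / poch (a + 1) k * _ = _
    rw [ih, show a + 1 + k = a + (k + 1) by ring]
    field_simp

lemma half_add_mul_betaIntegral (m : ℕ) :
    (1/2 + (m : ℂ)) * Complex.betaIntegral (1/2 + (m : ℂ)) (1/2 + (m : ℂ)) =
      (Real.pi : ℂ) / 2 ^ (2 * m + 1) * poch (3/2) m / (m ! : ℂ) := by
  set a : ℂ := 1/2 + (m : ℂ) with ha
  have hre : 0 < a.re := by
    simp [ha]
    positivity
  have ha0 : a ≠ 0 := fun h => by simp [h] at hre
  have hfac : (m ! : ℂ) ≠ 0 := by exact_mod_cast m.factorial_ne_zero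
  have hG : Complex.Gamma (a + a) ≠ 0 := Complex.Gamma_ne_zero_of_re_pos (by simpa using hre)
  have hbeta := Complex.Gamma_mul_Gamma_eq_betaIntegral hre hre
  have hdup := Complex.Gamma_mul_Gamma_add_half a
  rw [show a + 1 / 2 = m + 1 by rw [ha]; ring, Complex.Gamma_nat_eq_factorial, two_mul,
    show 1 - (a + a) = -((2 * m : ℕ) : ℂ) by rw [ha]; push_cast; ring, Complex.cpow_neg,
    Complex.cpow_natCast] at hdup
  have hpoch : Complex.Gamma a * a = poch (3/2) m * (Real.sqrt Real.pi / 2) := by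
    have h32 : Complex.Gamma (3/2) = Real.sqrt Real.pi / 2 := by
      rw [show (3/2 : ℂ) = 1/2 + 1 by norm_num, Complex.Gamma_add_one _ (by norm_num),
        Complex.Gamma_one_half_eq, Real.sqrt_eq_rpow, Complex.ofReal_cpow Real.pi_pos.le]
      push_cast
      ring
    have hz : ∀ k : ℕ, (3/2 : ℂ) ≠ -k := fun k h => by
      have := congrArg Complex.re h
      norm_num at this
      have : (0 : ℝ) ≤ k := k.cast_nonneg
      linarith
    rw [poch, ← Complex.Gamma_add_nat_div_Gamma_eq _ hz, h32, mul_comm, ← Complex.Gamma_add_one _ ha0,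
      show (3/2 : ℂ) + m = a + 1 by rw [ha]; ring, div_mul_cancel₀]
    rw [← h32]
    exact Complex.Gamma_ne_zero_of_re_pos (by norm_num)
  have hpi : (Real.sqrt Real.pi : ℂ) * Real.sqrt Real.pi = Real.pi := by
    rw [← Complex.ofReal_mul, Real.mul_self_sqrt Real.pi_pos.le]
  apply mul_left_cancel₀ hG
  apply mul_left_cancel₀ hfac
  calc (m ! : ℂ) * (Complex.Gamma (a + a) * (a * Complex.betaIntegral a a))
      = (Complex.Gamma a * m !) * (Complex.Gamma a * a) := by linear_combination (-(m ! : ℂ) * a) * hbeta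
    _ = Complex.Gamma (a + a) * (2 ^ (2 * m))⁻¹ * poch (3/2) m / 2 * Real.pi := by
      rw [hdup, hpoch, ← hpi]
      ring
    _ = _ := by
      field_simp
      ring

theorem gauss_pi_formula (m : ℕ) :
    hyp [1/2 + (m : ℂ), 1/2 - (m : ℂ)] [3/2 + (m : ℂ)] 1 =
      (Real.pi : ℂ) / 2 ^ (2 * m + 1) * poch (3/2) m / (m ! : ℂ) := by
  have hre : 0 < (1/2 + (m : ℂ)).re := by
    simp
    positivity
  have hb : (1/2 - m : ℝ) < 1 := by
    have : (0 : ℝ) ≤ m := m.cast_nonneg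
    linarith
  have h := (hasSum_poch_div_factorial_div_add hre hb).mul_left (1/2 + (m : ℂ))
  rw [show (1 : ℂ) - ((1/2 - m : ℝ) : ℂ) = 1/2 + m by push_cast; ring,
    half_add_mul_betaIntegral] at h
  rw [← h.tsum_eq, hyp]
  refine tsum_congr fun k => ?_
  simp only [List.map_cons, List.map_nil, List.prod_cons, List.prod_nil, mul_one, one_pow]
  rw [mul_div_right_comm, show (3/2 + m : ℂ) = 1/2 + m + 1 by ring, poch_div_poch_add_one hre]
  push_cast
  ring
end

section
/- Extension of Gauss's summation theorem: let a, b, c, d be complex numbers with Re(d) > 0 and Re(c − a − b) > 0, and such that c + 1 is not a nonpositive integer and none of c − a + 1, c − b + 1 is a nonpositive integer. Then ₃F₂(a, b, d+1; c+1, d; 1) = (Γ(c+1) Γ(c−a−b)) / (Γ(c−a+1) Γ(c−b+1)) · [(c − a − b) + ab/d]. -/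
open scoped Nat

open Complex Filter Topology Asymptotics

lemma poch_zero (x : ℂ) : poch x 0 = 1 := by simp [poch]

lemma poch_succ (x : ℂ) (k : ℕ) : poch x (k + 1) = poch x k * (x + k) := by
  simp [poch, ascPochhammer_succ_eval]

lemma poch_succ_left (x : ℂ) (k : ℕ) : poch x (k + 1) = x * poch (x + 1) k := by
  simp [poch, ascPochhammer_succ_left]

lemma poch_eq_prod (x : ℂ) (k : ℕ) : poch x k = ∏ j ∈ Finset.range k, (x + j) := by
  induction k with
  | zero => simp [poch_zero]
  | succ k ih => rw [poch_succ, Finset.prod_range_succ, ih]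

lemma poch_ne_zero {x : ℂ} (hx : ∀ n : ℕ, x ≠ -(n : ℂ)) (k : ℕ) : poch x k ≠ 0 := by
  rw [poch_eq_prod]
  exact Finset.prod_ne_zero_iff.2 fun j _ h => hx j (eq_neg_of_add_eq_zero_left h)

lemma ne_neg_natCast_of_re_pos {x : ℂ} (hx : 0 < x.re) (n : ℕ) : x ≠ -(n : ℂ) := by
  rintro rfl
  simp only [neg_re, natCast_re] at hx
  linarith [n.cast_nonneg (α := ℝ)]

lemma add_natCast_ne_neg_natCast {x : ℂ} (hx : ∀ n : ℕ, x ≠ -(n : ℂ)) (m n : ℕ) :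
    x + m ≠ -(n : ℂ) := fun h =>
  hx (n + m) (by push_cast; linear_combination h)

/-- Euler's limit formula for the reciprocal Gamma function, valid at the poles of `Γ` too. -/
lemma tendsto_poch_div (s : ℂ) :
    Tendsto (fun n : ℕ => poch s (n + 1) / ((n : ℂ) ^ s * n !)) atTop (𝓝 (Gamma s)⁻¹) := by
  by_cases hs : Gamma s = 0
  · obtain ⟨m, rfl⟩ := (Gamma_eq_zero_iff s).1 hs
    rw [hs, inv_zero]
    refine tendsto_const_nhds.congr' ?_
    filter_upwards [eventually_ge_atTop m] with n hn
    rw [poch_eq_prod, Finset.prod_eq_zero (i := m) (by simp; omega) (by simp), zero_div]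
  · refine ((GammaSeq_tendsto_Gamma s).inv₀ hs).congr fun n => ?_
    rw [GammaSeq, inv_div, poch_eq_prod]

/-- The `k`-th term of the Gauss hypergeometric series `₂F₁(a, b; c; 1)`. -/
noncomputable def gaussTerm (a b c : ℂ) (k : ℕ) : ℂ := poch a k * poch b k / (poch c k * k !)

lemma succ_mul_gaussTerm_succ (a b c : ℂ) (k : ℕ) :
    ((k : ℂ) + 1) * gaussTerm a b c (k + 1) = a * b / c * gaussTerm (a + 1) (b + 1) (c + 1) k := by
  have hk : (k : ℂ) + 1 ≠ 0 := Nat.cast_add_one_ne_zero k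
  simp only [gaussTerm, poch_succ_left, Nat.factorial_succ, Nat.cast_mul, Nat.cast_add,
    Nat.cast_one]
  rw [div_mul_div_comm, mul_div_assoc', show c * poch (c + 1) k * (((k : ℂ) + 1) * (k ! : ℂ)) =
    ((k : ℂ) + 1) * (c * (poch (c + 1) k * k !)) by ring, mul_div_mul_left _ _ hk]
  ring

lemma succ_mul_gaussTerm_isBigO (a b : ℂ) {c : ℂ} (hc : ∀ n : ℕ, c ≠ -(n : ℂ)) :
    (fun n : ℕ => ((n : ℂ) + 1) * gaussTerm a b c (n + 1)) =O[atTop]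
      fun n : ℕ => (n : ℝ) ^ (a + b - c).re := by
  have hlim := ((tendsto_poch_div a).mul (tendsto_poch_div b)).div (tendsto_poch_div c)
    (inv_ne_zero (Gamma_ne_zero hc))
  have h := (hlim.isBigO_one ℝ).mul (isBigO_refl (fun n : ℕ => (n : ℂ) ^ (a + b - c)) atTop).norm_right
  refine (h.congr' ?_ .rfl).trans ?_
  · filter_upwards [eventually_ge_atTop 1] with n hn
    have hn0 : (n : ℂ) ≠ 0 := by exact_mod_cast (by omega : n ≠ 0)
    have hk : (n : ℂ) + 1 ≠ 0 := Nat.cast_add_one_ne_zero n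
    have hf : (n ! : ℂ) ≠ 0 := by exact_mod_cast n.factorial_ne_zero
    have ha : (n : ℂ) ^ a ≠ 0 := by simp [cpow_eq_zero_iff, hn0]
    have hb : (n : ℂ) ^ b ≠ 0 := by simp [cpow_eq_zero_iff, hn0]
    have hcc : (n : ℂ) ^ c ≠ 0 := by simp [cpow_eq_zero_iff, hn0]
    have hp := poch_ne_zero hc (n + 1)
    simp only [gaussTerm, Nat.factorial_succ, Nat.cast_mul, Nat.cast_add, Nat.cast_one,
      Pi.div_apply]
    rw [cpow_sub _ _ hn0, cpow_add _ _ hn0]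
    field_simp
  · refine IsBigO.of_bound 1 ?_
    filter_upwards [eventually_ge_atTop 1] with n hn
    rw [one_mul, one_mul, norm_norm, norm_natCast_cpow_of_pos (by omega)]
    exact le_abs_self _

lemma summable_gaussTerm {a b c : ℂ} (hc : ∀ n : ℕ, c ≠ -(n : ℂ)) (h : 0 < (c - a - b).re) :
    Summable (gaussTerm a b c) := by
  rw [← summable_nat_add_iff 1]
  have hs : Summable fun n : ℕ => (n : ℝ) ^ ((a + b - c).re - 1) := by
    rw [Real.summable_nat_rpow]
    simp only [sub_re, add_re] at h ⊢
    linarith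
  refine summable_of_isBigO_nat hs ?_
  have h1 : (fun n : ℕ => ((n : ℂ) + 1)⁻¹) =O[atTop] fun n : ℕ => (n : ℝ)⁻¹ := by
    refine IsBigO.of_bound 1 ?_
    filter_upwards [eventually_ge_atTop 1] with n hn
    have hn' : (0 : ℝ) < n := by exact_mod_cast hn
    rw [one_mul, norm_inv, norm_inv, ← Nat.cast_add_one, norm_natCast, Real.norm_natCast]
    gcongr
    simp
  refine (h1.mul (succ_mul_gaussTerm_isBigO a b hc)).congr' ?_ ?_
  · filter_upwards with n
    rw [inv_mul_cancel_left₀ (Nat.cast_add_one_ne_zero n)]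
  · filter_upwards [eventually_ge_atTop 1] with n hn
    have hn' : (0 : ℝ) < n := by exact_mod_cast hn
    rw [Real.rpow_sub hn', Real.rpow_one]
    ring

lemma tendsto_mul_gaussTerm {a b c : ℂ} (hc : ∀ n : ℕ, c ≠ -(n : ℂ)) (h : 0 < (c - a - b).re) :
    Tendsto (fun n : ℕ => (n : ℂ) * gaussTerm a b c n) atTop (𝓝 0) := by
  rw [← tendsto_add_atTop_iff_nat 1]
  push_cast
  refine (succ_mul_gaussTerm_isBigO a b hc).trans_tendsto ?_
  have h' : 0 < -(a + b - c).re := by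
    simp only [sub_re, add_re] at h ⊢
    linarith
  simpa only [neg_neg, Function.comp_def] using
    (tendsto_rpow_neg_atTop h').comp (tendsto_natCast_atTop_atTop (R := ℝ))

lemma gaussTerm_contiguous (a b : ℂ) {c : ℂ} (hc : ∀ n : ℕ, c ≠ -(n : ℂ)) (k : ℕ) :
    (c - a) * (c - b) / c * gaussTerm a b (c + 1) k - (c - a - b) * gaussTerm a b c k =
      ((k + 1 : ℕ) : ℂ) * gaussTerm a b c (k + 1) - (k : ℂ) * gaussTerm a b c k := by
  have hc0 : c ≠ 0 := by simpa using hc 0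
  have hck : c + k ≠ 0 := fun h => hc k (eq_neg_of_add_eq_zero_left h)
  have hk : (k : ℂ) + 1 ≠ 0 := Nat.cast_add_one_ne_zero k
  have hf : (k ! : ℂ) ≠ 0 := by exact_mod_cast k.factorial_ne_zero
  have hp := poch_ne_zero hc k
  have hp1 : poch (c + 1) k = poch c k * (c + k) / c := by
    rw [eq_div_iff hc0, ← poch_succ, poch_succ_left, mul_comm]
  simp only [gaussTerm, hp1, poch_succ, Nat.factorial_succ, Nat.cast_mul, Nat.cast_add,
    Nat.cast_one]
  field_simp
  ring

lemma tsum_gaussTerm_recurrence {a b c : ℂ} (hc : ∀ n : ℕ, c ≠ -(n : ℂ))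
    (h : 0 < (c - a - b).re) :
    (c - a - b) * ∑' k, gaussTerm a b c k =
      (c - a) * (c - b) / c * ∑' k, gaussTerm a b (c + 1) k := by
  have hs := summable_gaussTerm hc h
  have hs' : Summable (gaussTerm a b (c + 1)) := by
    refine summable_gaussTerm (fun n => by simpa using add_natCast_ne_neg_natCast hc 1 n) ?_
    simp only [sub_re, add_re, one_re] at h ⊢
    linarith
  have hsum := ((hs'.hasSum.mul_left ((c - a) * (c - b) / c)).sub
    (hs.hasSum.mul_left (c - a - b))).tendsto_sum_nat
  simp only [gaussTerm_contiguous a b hc] at hsum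
  simp only [Finset.sum_range_sub (fun k : ℕ => (k : ℂ) * gaussTerm a b c k), Nat.cast_zero,
    zero_mul, sub_zero] at hsum
  have := tendsto_nhds_unique hsum (tendsto_mul_gaussTerm hc h)
  linear_combination -this

lemma poch_mul_tsum_gaussTerm {a b c : ℂ} (hc : ∀ n : ℕ, c ≠ -(n : ℂ))
    (h : 0 < (c - a - b).re) (n : ℕ) :
    ∑' k, gaussTerm a b c k = poch (c - a) n * poch (c - b) n /
      (poch c n * poch (c - a - b) n) * ∑' k, gaussTerm a b (c + n) k := by
  induction n with
  | zero => simp [poch_zero]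
  | succ n ih =>
    have hn : 0 < (c + n - a - b).re := by
      simp only [sub_re, add_re, natCast_re] at h ⊢
      linarith [n.cast_nonneg (α := ℝ)]
    have hcn := add_natCast_ne_neg_natCast hc n
    have hr := tsum_gaussTerm_recurrence hcn hn
    have h0 : c + n - a - b ≠ 0 := by simpa using ne_neg_natCast_of_re_pos hn 0
    have h0' : c - a - b + n ≠ 0 := by convert h0 using 1; ring
    have h1 : c + n ≠ 0 := by simpa using hcn 0
    have h2 := poch_ne_zero hc n
    have h3 := poch_ne_zero (ne_neg_natCast_of_re_pos h) n
    rw [mul_comm, ← eq_div_iff h0] at hr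
    rw [ih, hr, show c + ((n + 1 : ℕ) : ℂ) = c + n + 1 by push_cast; ring]
    simp only [poch_succ]
    rw [show c + (n : ℂ) - a - b = c - a - b + n by ring]
    field_simp
    ring

lemma tendsto_inv_poch_add_natCast (c : ℂ) (k : ℕ) :
    Tendsto (fun n : ℕ => (poch (c + n) k)⁻¹) atTop (𝓝 (if k = 0 then 1 else 0)) := by
  induction k with
  | zero => simp [poch_zero]
  | succ k ih =>
    have h : Tendsto (fun n : ℕ => (c + n + k)⁻¹) atTop (𝓝 0) := by
      refine tendsto_inv₀_cobounded.comp ?_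
      refine ((tendsto_add_const_cobounded (c + k)).comp
        (tendsto_natCast_atTop_cobounded (α := ℂ))).congr fun n => ?_
      simp only [Function.comp]
      ring
    simpa [poch_succ, mul_comm] using ih.mul h

lemma norm_poch_le_of_le_re {r : ℝ} (hr : 0 < r) {x : ℂ} (hx : r ≤ x.re) (k : ℕ) :
    ‖poch r k‖ ≤ ‖poch x k‖ := by
  rw [poch_eq_prod, poch_eq_prod, norm_prod, norm_prod]
  refine Finset.prod_le_prod (fun _ _ => norm_nonneg _) fun j _ => ?_
  have h1 : ‖(r : ℂ) + j‖ = r + j := by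
    rw [← ofReal_natCast, ← ofReal_add, norm_real, Real.norm_of_nonneg (by positivity)]
  rw [h1]
  refine le_trans ?_ (re_le_norm _)
  simpa using hx

lemma tendsto_tsum_gaussTerm (a b c : ℂ) :
    Tendsto (fun n : ℕ => ∑' k, gaussTerm a b (c + n) k) atTop (𝓝 1) := by
  set r : ℝ := max 1 ((a + b).re + 1)
  have hr : 0 < r := lt_max_of_lt_left one_pos
  have hrs : Summable (gaussTerm a b r) := by
    refine summable_gaussTerm (ne_neg_natCast_of_re_pos (by simpa using hr)) ?_
    have : (a + b).re + 1 ≤ r := le_max_right _ _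
    simp only [sub_re, add_re, ofReal_re] at this ⊢
    linarith
  have hlim : ∑' k : ℕ, (if k = 0 then (1 : ℂ) else 0) = 1 := by simp
  rw [← hlim]
  refine tendsto_tsum_of_dominated_convergence hrs.norm (fun k => ?_) ?_
  · have := (tendsto_inv_poch_add_natCast c k).const_mul (poch a k * poch b k / k !)
    convert this using 1
    · ext n
      rw [gaussTerm]
      ring
    · split_ifs with hk <;> simp [hk, poch_zero]
  · filter_upwards [tendsto_natCast_atTop_atTop.eventually_ge_atTop (r - c.re)] with n hn k
    have hx : r ≤ (c + n).re := by
      simp only [add_re, natCast_re]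
      linarith
    have hpos : 0 < ‖poch r k‖ :=
      norm_pos_iff.2 (poch_ne_zero (ne_neg_natCast_of_re_pos (by simpa using hr)) k)
    have hf : 0 < ‖(k ! : ℂ)‖ := norm_pos_iff.2 (by exact_mod_cast k.factorial_ne_zero)
    simp only [gaussTerm, norm_div, norm_mul]
    gcongr
    exact norm_poch_le_of_le_re hr hx k

/-- **Gauss's summation theorem** for `₂F₁(a, b; c; 1)`. -/
lemma tsum_gaussTerm {a b c : ℂ} (hc : ∀ n : ℕ, c ≠ -(n : ℂ)) (h : 0 < (c - a - b).re) :
    ∑' k, gaussTerm a b c k =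
      Gamma c * Gamma (c - a - b) / (Gamma (c - a) * Gamma (c - b)) := by
  have hcab := ne_neg_natCast_of_re_pos h
  have h1 := (((tendsto_poch_div (c - a)).mul (tendsto_poch_div (c - b))).div
    ((tendsto_poch_div c).mul (tendsto_poch_div (c - a - b)))
    (mul_ne_zero (inv_ne_zero (Gamma_ne_zero hc)) (inv_ne_zero (Gamma_ne_zero hcab)))).mul
    ((tendsto_add_atTop_iff_nat 1).2 (tendsto_tsum_gaussTerm a b c))
  have h2 : Tendsto (fun _ : ℕ => ∑' k, gaussTerm a b c k) atTop
      (𝓝 (∑' k, gaussTerm a b c k)) := tendsto_const_nhds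
  rw [← tendsto_nhds_unique (h1.congr' ?_) h2]
  · rw [mul_one, ← mul_inv, ← mul_inv, inv_div_inv]
  · filter_upwards [eventually_ge_atTop 1] with n hn
    have hn0 : (n : ℂ) ≠ 0 := by exact_mod_cast (by omega : n ≠ 0)
    have hf : (n ! : ℂ) ≠ 0 := by exact_mod_cast n.factorial_ne_zero
    have hpow (s : ℂ) : (n : ℂ) ^ s ≠ 0 := by simp [cpow_eq_zero_iff, hn0]
    have hexp : (n : ℂ) ^ (c - a) * (n : ℂ) ^ (c - b) =
        (n : ℂ) ^ c * (n : ℂ) ^ (c - a - b) := by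
      rw [← cpow_add _ _ hn0, ← cpow_add _ _ hn0]
      ring_nf
    rw [poch_mul_tsum_gaussTerm hc h (n + 1)]
    simp only [Pi.div_apply]
    congr 1
    rw [div_mul_div_comm, div_mul_div_comm,
      show (n : ℂ) ^ (c - a) * (n ! : ℂ) * ((n : ℂ) ^ (c - b) * (n ! : ℂ)) =
        (n : ℂ) ^ c * (n ! : ℂ) * ((n : ℂ) ^ (c - a - b) * (n ! : ℂ)) by
        linear_combination (n ! : ℂ) ^ 2 * hexp]
    exact div_div_div_cancel_right₀
      (mul_ne_zero (mul_ne_zero (hpow _) hf) (mul_ne_zero (hpow _) hf)) _ _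

lemma poch_add_one_div_poch {d : ℂ} (hd : ∀ n : ℕ, d ≠ -(n : ℂ)) (k : ℕ) :
    poch (d + 1) k / poch d k = 1 + k / d := by
  have hd0 : d ≠ 0 := by simpa using hd 0
  have h := (poch_succ_left d k).symm.trans (poch_succ d k)
  rw [div_eq_iff (poch_ne_zero hd k)]
  field_simp
  linear_combination h

theorem extended_gauss_summation (a b c d : ℂ) (hd : 0 < d.re)
    (hcab : 0 < (c - a - b).re)
    (hc : ∀ n : ℕ, c + 1 ≠ -(n : ℂ))
    (hca : ∀ n : ℕ, c - a + 1 ≠ -(n : ℂ))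
    (hcb : ∀ n : ℕ, c - b + 1 ≠ -(n : ℂ)) :
    hyp [a, b, d + 1] [c + 1, d] 1 =
      Complex.Gamma (c + 1) * Complex.Gamma (c - a - b) /
        (Complex.Gamma (c - a + 1) * Complex.Gamma (c - b + 1)) *
        ((c - a - b) + a * b / d) := by
  have hdn := ne_neg_natCast_of_re_pos hd
  have hc0 : c + 1 ≠ 0 := by simpa using hc 0
  have hcab0 : c - a - b ≠ 0 := by simpa using ne_neg_natCast_of_re_pos hcab 0
  have hc' : ∀ n : ℕ, c + 1 + 1 ≠ -(n : ℂ) := fun n => by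
    simpa using add_natCast_ne_neg_natCast hc 1 n
  have hre : 0 < (c + 1 - a - b).re := by
    simp only [sub_re, add_re, one_re] at hcab ⊢
    linarith
  have hre' : 0 < (c + 1 + 1 - (a + 1) - (b + 1)).re := by
    convert hcab using 2
    ring
  have hs := (summable_gaussTerm hc hre).hasSum
  have hs' : HasSum (fun k : ℕ => (k : ℂ) * gaussTerm a b (c + 1) k)
      (a * b / (c + 1) * ∑' k, gaussTerm (a + 1) (b + 1) (c + 1 + 1) k) := by
    rw [← hasSum_nat_add_iff' 1]
    simpa [succ_mul_gaussTerm_succ] using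
      (summable_gaussTerm hc' hre').hasSum.mul_left (a * b / (c + 1))
  have hterm : hyp [a, b, d + 1] [c + 1, d] 1 =
      ∑' k : ℕ, (gaussTerm a b (c + 1) k + 1 / d * ((k : ℂ) * gaussTerm a b (c + 1) k)) := by
    refine tsum_congr fun k => ?_
    have h := poch_add_one_div_poch hdn k
    simp only [List.map_cons, List.map_nil, List.prod_cons, List.prod_nil, mul_one, one_pow]
    calc _ = gaussTerm a b (c + 1) k * (poch (d + 1) k / poch d k) := by
          rw [gaussTerm, div_mul_div_comm, div_div]
          ring
      _ = _ := by rw [h]; ring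
  rw [hterm, (hs.add (hs'.mul_left (1 / d))).tsum_eq, tsum_gaussTerm hc hre,
    tsum_gaussTerm hc' hre', Gamma_add_one _ hc0,
    show c + 1 - a - b = c - a - b + 1 by ring, Gamma_add_one _ hcab0,
    show c + 1 + 1 - (a + 1) - (b + 1) = c - a - b by ring,
    show c + 1 + 1 - (a + 1) = c - a + 1 by ring,
    show c + 1 + 1 - (b + 1) = c - b + 1 by ring,
    show c + 1 - a = c - a + 1 by ring, show c + 1 - b = c - b + 1 by ring]
  have hga := Gamma_ne_zero hca
  have hgb := Gamma_ne_zero hcb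
  have hd0 : d ≠ 0 := by simpa using hdn 0
  field_simp
end
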